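/- Fix ω₀ > 0 and ω₁ > 0, set ω(λ) = √(ω₀² + 2ω₁²(1 − cos λ)) and ω₀' = √(ω₀² + 4ω₁²). Let Q, P : ℝ → ℂ be twice continuously differentiable 2π-periodic functions and define q_k(t) = (1/2π)·∫₀^{2π}( Q(λ)·cos(t·ω(λ)) + P(λ)·sin(t·ω(λ))/ω(λ) )·e^{−ikλ} dλ. Set C₁ = (1/ω₁)·√(ω₀/(2π))·Q(0), S₁ = (1/(ω₁ω₀))·√(ω₀/(2π))·P(0), C₂ = (1/ω₁)·√(ω₀'/(2π))·Q(π), S₂ = (1/(ω₁ω₀'))·√(ω₀'/(2π))·P(π). Then for every fixed k ∈ ℤ: lim_{t→∞} [ √t·q_k(t) − ( C₁·cos(tω₀ + π/4) + S₁·sin(tω₀ + π/4) + (−1)^k·C₂·cos(tω₀' − π/4) + (−1)^k·S₂·sin(tω₀' − π/4) ) ] = 0. -/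

import Mathlib

open scoped Real
open MeasureTheory Complex Filter

/-- A `C¹` function vanishing at `0` and `π` is dominated by the sine on `[0, π]`. -/
lemma exists_norm_le_mul_sin {F : ℝ → ℂ} (hF : ContDiff ℝ 1 F) (h0 : F 0 = 0) (hπ : F π = 0) :
    ∃ K : ℝ, 0 ≤ K ∧ ∀ l ∈ Set.Icc 0 π, ‖F l‖ ≤ K * Real.sin l ∧ ‖deriv F l‖ ≤ K := by
  obtain ⟨M, hM⟩ := isCompact_Icc.exists_bound_of_continuousOn (s := Set.Icc 0 π)
    (hF.continuous_deriv le_rfl).continuousOn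
  have hM0 : 0 ≤ M := (norm_nonneg _).trans (hM 0 ⟨le_rfl, Real.pi_pos.le⟩)
  have hdiff : Differentiable ℝ F := hF.differentiable (by simp)
  have hlip : ∀ x ∈ Set.Icc 0 π, ∀ y ∈ Set.Icc 0 π, ‖F y - F x‖ ≤ M * ‖y - x‖ := fun x hx y hy =>
    Convex.norm_image_sub_le_of_norm_deriv_le (s := Set.Icc 0 π) (fun x _ => hdiff x) hM
      (convex_Icc 0 π) hx hy
  have hpi := Real.pi_gt_three
  refine ⟨M * (π / 2), by positivity, fun l hl => ⟨?_, (hM l hl).trans ?_⟩⟩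
  · rcases le_total l (π / 2) with h | h
    · have h1 := hlip 0 ⟨le_rfl, Real.pi_pos.le⟩ l hl
      rw [h0, sub_zero, sub_zero, Real.norm_eq_abs, abs_of_nonneg hl.1] at h1
      have h2 := Real.mul_le_sin hl.1 h
      calc ‖F l‖ ≤ M * l := h1
        _ = M * (π / 2) * (2 / π * l) := by field_simp
        _ ≤ _ := by gcongr
    · have h1 := hlip π ⟨Real.pi_pos.le, le_rfl⟩ l hl
      rw [hπ, sub_zero, Real.norm_eq_abs, abs_sub_comm, abs_of_nonneg (by linarith [hl.2])] at h1
      have h2 := Real.mul_le_sin (x := π - l) (by linarith [hl.2]) (by linarith)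
      rw [Real.sin_pi_sub] at h2
      calc ‖F l‖ ≤ M * (π - l) := h1
        _ = M * (π / 2) * (2 / π * (π - l)) := by field_simp
        _ ≤ _ := by gcongr
  · nlinarith

/-- The truncated Gaussian tail with complex parameter decays like `1 / ‖b‖`. -/
lemma norm_integral_Ioi_cexp_neg_mul_sq_le {S : ℝ} (hS : 0 < S) :
    ∃ C : ℝ, ∀ b : ℂ, b.re = 1 →
      ‖∫ u in Set.Ioi S, cexp (-b * (u : ℂ) ^ 2)‖ ≤ C / ‖b‖ := by
  have hreal : Integrable (fun u : ℝ => Real.exp (-1 * u ^ 2)) := integrable_exp_neg_mul_sq one_pos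
  refine ⟨1 / (2 * S) + (∫ u in Set.Ioi S, Real.exp (-1 * u ^ 2) / (2 * S ^ 2)), fun b hb => ?_⟩
  have hb0 : b ≠ 0 := by rintro rfl; simp at hb
  have hbpos : 0 < ‖b‖ := norm_pos_iff.2 hb0
  have hnorm : ∀ u : ℝ, ‖cexp (-b * (u : ℂ) ^ 2)‖ = Real.exp (-1 * u ^ 2) := fun u => by
    rw [norm_exp, ← ofReal_pow, re_mul_ofReal, neg_re, hb]
  have hint : Integrable (fun u : ℝ => cexp (-b * (u : ℂ) ^ 2)) :=
    integrable_cexp_neg_mul_sq (by rw [hb]; exact one_pos)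
  have hbd : ∀ u ∈ Set.Ioi S, ‖cexp (-b * (u : ℂ) ^ 2) / (2 * b * u ^ 2)‖ ≤
      Real.exp (-1 * u ^ 2) / (2 * S ^ 2) / ‖b‖ := fun u hu => by
    have hu' : S < u := hu
    have hu0 : 0 < u := hS.trans hu'
    rw [norm_div, hnorm, div_div]
    simp only [norm_mul, norm_pow, norm_real, Real.norm_eq_abs, abs_of_pos hu0, Complex.norm_ofNat]
    rw [mul_right_comm]
    gcongr
  have hint2 : IntegrableOn (fun u : ℝ => cexp (-b * (u : ℂ) ^ 2) / (2 * b * u ^ 2)) (Set.Ioi S) := by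
    refine Integrable.mono' ((hreal.div_const (2 * S ^ 2)).div_const ‖b‖).integrableOn ?_ ?_
    · exact Measurable.aestronglyMeasurable (by fun_prop)
    · exact (ae_restrict_iff' measurableSet_Ioi).2 (ae_of_all _ hbd)
  have hderiv : ∀ u ∈ Set.Ici S, HasDerivAt (fun u : ℝ => -cexp (-b * (u : ℂ) ^ 2) / (2 * b * u))
      (cexp (-b * (u : ℂ) ^ 2) + cexp (-b * (u : ℂ) ^ 2) / (2 * b * u ^ 2)) u := fun u hu => by
    have hu0 : (u : ℂ) ≠ 0 := ofReal_ne_zero.2 (hS.trans_le hu).ne'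
    have h1 : HasDerivAt (fun z : ℂ => -cexp (-b * z ^ 2) / (2 * b * z))
        (cexp (-b * (u : ℂ) ^ 2) + cexp (-b * (u : ℂ) ^ 2) / (2 * b * u ^ 2)) (u : ℂ) := by
      have h2 := ((((hasDerivAt_id (u : ℂ)).pow 2).const_mul (-b)).cexp.neg).div
        ((hasDerivAt_id (u : ℂ)).const_mul (2 * b)) (by simp [hb0, hu0])
      refine HasDerivAt.congr_deriv h2 ?_
      simp only [id, Pi.pow_apply, Pi.neg_apply]
      field_simp
      push_cast
      ring
    exact h1.comp_ofReal
  have hlim : Tendsto (fun u : ℝ => -cexp (-b * (u : ℂ) ^ 2) / (2 * b * u)) atTop (nhds 0) := by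
    rw [tendsto_zero_iff_norm_tendsto_zero]
    have : Tendsto (fun u : ℝ => 1 / (2 * ‖b‖) * u⁻¹) atTop (nhds 0) := by
      simpa using tendsto_inv_atTop_zero.const_mul (1 / (2 * ‖b‖))
    refine squeeze_zero' (Eventually.of_forall fun _ => norm_nonneg _) ?_ this
    filter_upwards [eventually_gt_atTop 0] with u hu
    rw [norm_div, norm_neg, hnorm]
    simp only [norm_mul, norm_real, Real.norm_eq_abs, abs_of_pos hu, Complex.norm_ofNat]
    rw [← one_div, div_mul_div_comm, one_mul]
    gcongr
    exact Real.exp_le_one_iff.2 (by nlinarith)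
  have key := integral_Ioi_of_hasDerivAt_of_tendsto' hderiv (hint.integrableOn.add hint2) hlim
  rw [integral_add hint.integrableOn hint2] at key
  have h2 : ‖∫ u in Set.Ioi S, cexp (-b * (u : ℂ) ^ 2) / (2 * b * u ^ 2)‖ ≤
      (∫ u in Set.Ioi S, Real.exp (-1 * u ^ 2) / (2 * S ^ 2)) / ‖b‖ := by
    rw [← integral_div]
    exact norm_integral_le_of_norm_le ((hreal.div_const (2 * S ^ 2)).div_const ‖b‖).integrableOn
      ((ae_restrict_iff' measurableSet_Ioi).2 (ae_of_all _ hbd))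
  have h3 : ‖-cexp (-b * (S : ℂ) ^ 2) / (2 * b * S)‖ ≤ 1 / (2 * S) / ‖b‖ := by
    rw [norm_div, norm_neg, hnorm, div_div]
    simp only [norm_mul, norm_real, Real.norm_eq_abs, abs_of_pos hS, Complex.norm_ofNat]
    rw [mul_right_comm]
    gcongr
    exact Real.exp_le_one_iff.2 (by nlinarith)
  rw [eq_sub_of_add_eq key, add_div]
  refine (norm_sub_le _ _).trans (add_le_add ?_ h2)
  rwa [zero_sub, norm_neg]

/-- Positive real factors can be pulled out of a complex square root. -/
lemma ofReal_mul_cpow_half {a : ℝ} (ha : 0 < a) {z : ℂ} (hz : z ≠ 0) :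
    ((a : ℂ) * z) ^ (1 / 2 : ℂ) = (Real.sqrt a : ℂ) * z ^ (1 / 2 : ℂ) := by
  have ha' : (a : ℂ) ≠ 0 := ofReal_ne_zero.2 ha.ne'
  rw [cpow_def_of_ne_zero (mul_ne_zero ha' hz), log_ofReal_mul ha hz, add_mul, Complex.exp_add,
    cpow_def_of_ne_zero hz, Real.sqrt_eq_rpow, Real.rpow_def_of_pos ha]
  push_cast
  rfl

/-- Fresnel asymptotics with a Gaussian amplitude. -/
lemma tendsto_sqrt_mul_fresnel {S : ℝ} (hS : 0 < S) :
    Tendsto (fun t : ℝ => (Real.sqrt t : ℂ) *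
        ∫ u in (0 : ℝ)..S, cexp (-(u : ℂ) ^ 2) * cexp (I * t * (u : ℂ) ^ 2)) atTop
      (nhds ((Real.sqrt π / 2 : ℝ) * cexp (I * (π / 4 : ℝ)))) := by
  have hre : ∀ t : ℝ, (1 - I * (t : ℂ)).re = 1 := fun t => by simp
  obtain ⟨C, hC⟩ := norm_integral_Ioi_cexp_neg_mul_sq_le hS
  have hsplit : ∀ t : ℝ, (∫ u in (0 : ℝ)..S, cexp (-(u : ℂ) ^ 2) * cexp (I * t * (u : ℂ) ^ 2)) =
      (π / (1 - I * (t : ℂ))) ^ (1 / 2 : ℂ) / 2 -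
        ∫ u in Set.Ioi S, cexp (-(1 - I * (t : ℂ)) * (u : ℂ) ^ 2) := fun t => by
    have hint : Integrable (fun u : ℝ => cexp (-(1 - I * (t : ℂ)) * (u : ℂ) ^ 2)) :=
      integrable_cexp_neg_mul_sq (by rw [hre]; exact one_pos)
    rw [← integral_gaussian_complex_Ioi (by rw [hre]; exact one_pos),
      ← intervalIntegral.integral_interval_add_Ioi hint.integrableOn hint.integrableOn,
      add_sub_cancel_right]
    refine intervalIntegral.integral_congr fun u _ => ?_
    simp only [← Complex.exp_add]
    ring_nf
  have hmain : Tendsto (fun t : ℝ => (Real.sqrt t : ℂ) *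
      ((π / (1 - I * (t : ℂ))) ^ (1 / 2 : ℂ) / 2)) atTop
      (nhds ((Real.sqrt π / 2 : ℝ) * cexp (I * (π / 4 : ℝ)))) := by
    have hin : Tendsto (fun t : ℝ => (π : ℂ) / ((t⁻¹ : ℝ) - I)) atTop (nhds (π * I)) := by
      have h1 : Tendsto (fun t : ℝ => ((t⁻¹ : ℝ) : ℂ)) atTop (nhds ((0 : ℝ) : ℂ)) :=
        (continuous_ofReal.tendsto 0).comp tendsto_inv_atTop_zero
      have h2 := (tendsto_const_nhds (x := (π : ℂ))).div (h1.sub_const I) (by simp)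
      have h3 : (π : ℂ) * I = π / (((0 : ℝ) : ℂ) - I) := by
        rw [ofReal_zero, zero_sub, div_neg, div_I, neg_neg]
      rw [h3]
      exact h2
    have hslit : (π : ℂ) * I ∈ slitPlane := by
      right; simp [Real.pi_ne_zero]
    have h3 := ((continuousAt_cpow_const (b := 1 / 2) hslit).tendsto.comp hin).div_const 2
    have hval : ((π : ℂ) * I) ^ (1 / 2 : ℂ) / 2 = (Real.sqrt π / 2 : ℝ) * cexp (I * (π / 4 : ℝ)) := by
      rw [ofReal_mul_cpow_half Real.pi_pos I_ne_zero, cpow_def_of_ne_zero I_ne_zero, log_I,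
        show (π : ℂ) / 2 * I * (1 / 2) = I * (π / 4 : ℝ) by push_cast; ring]
      push_cast
      ring
    rw [hval] at h3
    refine h3.congr' ?_
    filter_upwards [eventually_gt_atTop 0] with t ht
    have hne : (1 : ℂ) - I * t ≠ 0 := fun h => by simpa [h] using hre t
    have ht' : (t : ℂ) ≠ 0 := ofReal_ne_zero.2 ht.ne'
    rw [← mul_div_assoc, ← ofReal_mul_cpow_half ht
      (div_ne_zero (ofReal_ne_zero.2 Real.pi_ne_zero) hne)]
    simp only [Function.comp]
    congr 2
    rw [ofReal_inv, mul_div_assoc', ← div_div_eq_mul_div (t : ℂ)]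
    have hne2 : (t : ℂ)⁻¹ - I ≠ 0 := fun h => hne (by
      rw [← mul_inv_cancel₀ ht', mul_comm I, ← mul_sub, h, mul_zero])
    field_simp
  have htail : Tendsto (fun t : ℝ => (Real.sqrt t : ℂ) *
      ∫ u in Set.Ioi S, cexp (-(1 - I * (t : ℂ)) * (u : ℂ) ^ 2)) atTop (nhds 0) := by
    rw [tendsto_zero_iff_norm_tendsto_zero]
    have : Tendsto (fun t : ℝ => |C| * (Real.sqrt t)⁻¹) atTop (nhds 0) := by
      simpa using (Real.tendsto_sqrt_atTop.inv_tendsto_atTop).const_mul |C|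
    refine squeeze_zero' (Eventually.of_forall fun _ => norm_nonneg _) ?_ this
    filter_upwards [eventually_gt_atTop 0] with t ht
    have hb : t ≤ ‖1 - I * (t : ℂ)‖ := by
      have := Complex.abs_im_le_norm (1 - I * (t : ℂ))
      simpa [abs_of_pos ht] using this
    have hs := Real.sqrt_pos.2 ht
    rw [norm_mul, norm_real, Real.norm_eq_abs, abs_of_pos hs]
    calc _ ≤ Real.sqrt t * (|C| / t) := by
          gcongr
          refine (hC _ (hre t)).trans ?_
          gcongr
          exact le_abs_self C
      _ = _ := by
          nth_rw 2 [← Real.mul_self_sqrt ht.le]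
          field_simp
  have := hmain.sub htail
  rw [sub_zero] at this
  refine this.congr fun t => ?_
  rw [hsplit, mul_sub]

lemma norm_cexp_I_mul_mul (t x : ℝ) : ‖cexp (I * t * x)‖ = 1 := by
  rw [mul_assoc, ← ofReal_mul, mul_comm, norm_exp_ofReal_mul_I]

/-- Non-asymptotic bound for an oscillatory integral whose amplitude vanishes at both stationary
points `0` and `π` of the phase. -/
lemma norm_integral_mul_cexp_le {φ w : ℝ → ℝ} {r : ℝ → ℂ} (hw : ContDiff ℝ 1 w)
    (hw0 : ∀ l, w l ≠ 0) (hφ : ∀ l, HasDerivAt φ (Real.sin l / w l) l) (hr : ContDiff ℝ 1 r)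
    (hr0 : r 0 = 0) (hrπ : r π = 0) :
    ∃ K : ℝ, ∀ t : ℝ, 0 < t → ∀ δ : ℝ, 0 < δ → δ ≤ 1 →
      ‖∫ l in (0 : ℝ)..π, r l * cexp (I * t * φ l)‖ ≤ K * (δ ^ 2 + (1 + δ⁻¹) / t) := by
  obtain ⟨K, hK0, hK⟩ := exists_norm_le_mul_sin hr hr0 hrπ
  set R : ℝ → ℂ := fun l => r l * w l with hR
  have hRc : ContDiff ℝ 1 R := hr.mul (ofRealCLM.contDiff.comp hw)
  obtain ⟨L, hL0, hL⟩ := exists_norm_le_mul_sin hRc (by simp [hR, hr0]) (by simp [hR, hrπ])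
  have hpi := Real.pi_gt_three
  have hφc : Continuous φ := continuous_iff_continuousAt.2 fun l => (hφ l).continuousAt
  refine ⟨2 * K + 2 * L + π ^ 2 * L, fun t ht δ hδ hδ1 => ?_⟩
  have ht' : (t : ℂ) ≠ 0 := ofReal_ne_zero.2 ht.ne'
  set g : ℝ → ℂ := fun l => r l * cexp (I * t * φ l) with hg
  have hgc : Continuous g := by
    have := hr.continuous
    fun_prop
  have hgi : ∀ a b, IntervalIntegrable g volume a b := fun a b => hgc.intervalIntegrable a b
  have hgn : ∀ l, ‖g l‖ = ‖r l‖ := fun l => by rw [hg]; simp only [norm_mul, norm_cexp_I_mul_mul, mul_one]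
  have hleft : ‖∫ l in (0 : ℝ)..δ, g l‖ ≤ K * δ ^ 2 := by
    have := intervalIntegral.norm_integral_le_of_norm_le_const (a := 0) (b := δ) (f := g)
      (C := K * δ) fun l hl => by
        rw [Set.uIoc_of_le hδ.le] at hl
        rw [hgn]
        refine (hK l ⟨hl.1.le, by linarith [hl.2]⟩).1.trans ?_
        gcongr
        exact (Real.sin_le hl.1.le).trans hl.2
    rwa [sub_zero, abs_of_pos hδ, mul_assoc, ← sq] at this
  have hright : ‖∫ l in (π - δ)..π, g l‖ ≤ K * δ ^ 2 := by
    have := intervalIntegral.norm_integral_le_of_norm_le_const (a := π - δ) (b := π) (f := g)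
      (C := K * δ) fun l hl => by
        rw [Set.uIoc_of_le (by linarith)] at hl
        rw [hgn]
        refine (hK l ⟨by linarith [hl.1], hl.2⟩).1.trans ?_
        gcongr
        rw [← Real.sin_pi_sub]
        exact (Real.sin_le (by linarith [hl.2])).trans (by linarith [hl.1])
    rwa [sub_sub_cancel, abs_of_pos hδ, mul_assoc, ← sq] at this
  have hsin : ∀ l ∈ Set.Icc δ (π - δ), 2 / π * δ ≤ Real.sin l := fun l hl => by
    rcases le_total l (π / 2) with h | h
    · refine le_trans ?_ (Real.mul_le_sin (hδ.le.trans hl.1) h)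
      gcongr
      exact hl.1
    · rw [← Real.sin_pi_sub]
      refine le_trans ?_ (Real.mul_le_sin (x := π - l) (by linarith [hl.2]) (by linarith))
      gcongr
      linarith [hl.2]
  have hsinpos : ∀ l ∈ Set.Icc δ (π - δ), 0 < Real.sin l := fun l hl =>
    lt_of_lt_of_le (by positivity) (hsin l hl)
  have hsin0 : ∀ l ∈ Set.Icc δ (π - δ), (Real.sin l : ℂ) ≠ 0 := fun l hl =>
    ofReal_ne_zero.2 (hsinpos l hl).ne'
  have hle : δ ≤ π - δ := by linarith
  set u' : ℝ → ℂ := fun l => (deriv R l * Real.sin l - R l * Real.cos l) / (Real.sin l : ℂ) ^ 2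
    with hu'
  have hu : ∀ l ∈ Set.Icc δ (π - δ), HasDerivAt (fun l => R l / (Real.sin l : ℂ)) (u' l) l :=
    fun l hl => ((hRc.differentiable (by simp) l).hasDerivAt).div
      (Real.hasDerivAt_sin l).ofReal_comp (hsin0 l hl)
  have hu'c : ContinuousOn u' (Set.Icc δ (π - δ)) := by
    have h1 := hRc.continuous_deriv le_rfl
    have h2 := hRc.continuous
    refine ContinuousOn.div (Continuous.continuousOn ?_) (Continuous.continuousOn ?_)
      fun l hl => pow_ne_zero 2 (hsin0 l hl)
    · have h3 := Real.continuous_sin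
      have h4 := Real.continuous_cos
      fun_prop
    · fun_prop
  set v' : ℝ → ℂ := fun l => cexp (I * t * φ l) * (I * t * (Real.sin l / w l : ℝ)) with hv'
  have hv : ∀ l, HasDerivAt (fun l => cexp (I * t * φ l)) (v' l) l := fun l =>
    ((hφ l).ofReal_comp.const_mul (I * t)).cexp
  have hv'c : Continuous v' := by
    have h1 : Continuous fun l => Real.sin l / w l := Real.continuous_sin.div hw.continuous hw0
    fun_prop
  have hparts := intervalIntegral.integral_mul_deriv_eq_deriv_mul (a := δ) (b := π - δ)
    (by rwa [Set.uIcc_of_le hle]) (fun l _ => hv l)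
    (ContinuousOn.intervalIntegrable (by rwa [Set.uIcc_of_le hle]))
    (hv'c.intervalIntegrable _ _)
  have hmid : (I * t) * ∫ l in δ..(π - δ), g l = ∫ l in δ..(π - δ),
      R l / (Real.sin l : ℂ) * v' l := by
    rw [← intervalIntegral.integral_const_mul]
    refine intervalIntegral.integral_congr fun l hl => ?_
    rw [Set.uIcc_of_le hle] at hl
    have h1 := hsin0 l hl
    have h2 : (w l : ℂ) ≠ 0 := ofReal_ne_zero.2 (hw0 l)
    simp only [hg, hR, hv', ofReal_div]
    field_simp
  have hub : ∀ l ∈ Set.Icc δ (π - δ), ‖R l / (Real.sin l : ℂ)‖ ≤ L := fun l hl => by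
    rw [norm_div, norm_real, Real.norm_eq_abs, abs_of_pos (hsinpos l hl),
      div_le_iff₀ (hsinpos l hl)]
    exact (hL l ⟨by linarith [hl.1], by linarith [hl.2]⟩).1
  have hu'b : ∀ l ∈ Set.Icc δ (π - δ), ‖u' l‖ ≤ L * π * δ⁻¹ := fun l hl => by
    have hs := hsinpos l hl
    obtain ⟨h1, h2⟩ := hL l ⟨by linarith [hl.1], by linarith [hl.2]⟩
    have h3 : ‖deriv R l * Real.sin l - R l * Real.cos l‖ ≤ 2 * L * Real.sin l := by
      refine (norm_sub_le _ _).trans ?_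
      rw [norm_mul, norm_mul, norm_real, norm_real, Real.norm_eq_abs, Real.norm_eq_abs,
        abs_of_pos hs]
      have h4 := Real.abs_cos_le_one l
      have h5 : ‖R l‖ * |Real.cos l| ≤ L * Real.sin l * 1 := by gcongr
      have h6 : ‖deriv R l‖ * Real.sin l ≤ L * Real.sin l := by gcongr
      linarith
    rw [hu']
    simp only [norm_div, norm_pow, norm_real, Real.norm_eq_abs, abs_of_pos hs]
    calc _ ≤ 2 * L * Real.sin l / Real.sin l ^ 2 := by gcongr
      _ = 2 * L / Real.sin l := by field_simp
      _ ≤ 2 * L / (2 / π * δ) := by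
        have := hsin l hl
        gcongr
      _ = _ := by field_simp
  have hmidb : t * ‖∫ l in δ..(π - δ), g l‖ ≤ 2 * L + π ^ 2 * L * δ⁻¹ := by
    have h1 : ‖(I * t) * ∫ l in δ..(π - δ), g l‖ = t * ‖∫ l in δ..(π - δ), g l‖ := by
      rw [norm_mul, norm_mul, norm_I, one_mul, norm_real, Real.norm_eq_abs, abs_of_pos ht]
    rw [← h1, hmid, hparts]
    have h2 := intervalIntegral.norm_integral_le_of_norm_le_const (a := δ) (b := π - δ)
      (f := fun l => u' l * cexp (I * t * φ l)) (C := L * π * δ⁻¹) fun l hl => by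
        rw [Set.uIoc_of_le hle] at hl
        rw [norm_mul, norm_cexp_I_mul_mul, mul_one]
        exact hu'b l ⟨hl.1.le, hl.2⟩
    have h3 : L * π * δ⁻¹ * |π - δ - δ| ≤ L * π * δ⁻¹ * π := by
      gcongr
      rw [abs_of_nonneg (by linarith)]
      linarith
    refine (norm_sub_le _ _).trans ?_
    refine (add_le_add ((norm_sub_le _ _).trans (add_le_add ?_ ?_)) (h2.trans h3)).trans
      (b := L + L + L * π * δ⁻¹ * π) (by ring_nf; rfl)
    · rw [norm_mul, norm_cexp_I_mul_mul, mul_one]; exact hub _ ⟨hle, le_rfl⟩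
    · rw [norm_mul, norm_cexp_I_mul_mul, mul_one]; exact hub _ ⟨le_rfl, hle⟩
  rw [← intervalIntegral.integral_add_adjacent_intervals (hgi 0 (π - δ)) (hgi (π - δ) π),
    ← intervalIntegral.integral_add_adjacent_intervals (hgi 0 δ) (hgi δ (π - δ))]
  have hmid2 : ‖∫ l in δ..(π - δ), g l‖ ≤ (2 * L + π ^ 2 * L * δ⁻¹) / t := by
    rw [le_div_iff₀ ht, mul_comm]; exact hmidb
  refine (norm_add₃_le).trans ?_
  have h1 : (2 * L + π ^ 2 * L * δ⁻¹) / t ≤ (2 * L + π ^ 2 * L) * ((1 + δ⁻¹) / t) := by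
    rw [← mul_div_assoc]
    gcongr
    have h2 : 0 ≤ 2 * L * δ⁻¹ := by positivity
    have h3 : 0 ≤ π ^ 2 * L := by positivity
    nlinarith
  have h2 : 0 ≤ (2 * L + π ^ 2 * L) * δ ^ 2 := by positivity
  have h3 : 0 ≤ 2 * K * ((1 + δ⁻¹) / t) := by positivity
  nlinarith

/-- An oscillatory integral whose amplitude vanishes at the stationary points of the phase is
`o(1 / √t)`. -/
lemma tendsto_sqrt_mul_integral_zero {φ w : ℝ → ℝ} {r : ℝ → ℂ} (hw : ContDiff ℝ 1 w)
    (hw0 : ∀ l, w l ≠ 0) (hφ : ∀ l, HasDerivAt φ (Real.sin l / w l) l) (hr : ContDiff ℝ 1 r)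
    (hr0 : r 0 = 0) (hrπ : r π = 0) :
    Tendsto (fun t : ℝ => (Real.sqrt t : ℂ) * ∫ l in (0 : ℝ)..π, r l * cexp (I * t * φ l))
      atTop (nhds 0) := by
  obtain ⟨K, hK⟩ := norm_integral_mul_cexp_le hw hw0 hφ hr hr0 hrπ
  rw [tendsto_zero_iff_norm_tendsto_zero]
  have hlim : Tendsto (fun t : ℝ => K * (t ^ (-(1 / 6) : ℝ) + (t ^ (-(1 / 2) : ℝ) +
      t ^ (-(1 / 6) : ℝ)))) atTop (nhds 0) := by
    have h1 := tendsto_rpow_neg_atTop (y := 1 / 6) (by norm_num)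
    have h2 := tendsto_rpow_neg_atTop (y := 1 / 2) (by norm_num)
    simpa using (h1.add (h2.add h1)).const_mul K
  refine squeeze_zero' (Eventually.of_forall fun _ => norm_nonneg _) ?_ hlim
  filter_upwards [eventually_ge_atTop 1] with t ht
  have ht0 : 0 < t := by linarith
  have h := hK t ht0 (t ^ (-(1 / 3) : ℝ)) (by positivity)
    (Real.rpow_le_one_of_one_le_of_nonpos ht (by norm_num))
  rw [norm_mul, norm_real, Real.norm_eq_abs, abs_of_nonneg (Real.sqrt_nonneg t)]
  refine (mul_le_mul_of_nonneg_left h (Real.sqrt_nonneg t)).trans_eq ?_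
  have e1 : Real.sqrt t * (t ^ (-(1 / 3) : ℝ)) ^ 2 = t ^ (-(1 / 6) : ℝ) := by
    rw [Real.sqrt_eq_rpow, ← Real.rpow_mul_natCast ht0.le, ← Real.rpow_add ht0]
    norm_num
  have e2 : Real.sqrt t / t = t ^ (-(1 / 2) : ℝ) := by
    rw [Real.sqrt_eq_rpow]
    nth_rw 2 [← Real.rpow_one t]
    rw [← Real.rpow_sub ht0]
    norm_num
  have e3 : t ^ (-(1 / 2) : ℝ) * (t ^ (-(1 / 3) : ℝ))⁻¹ = t ^ (-(1 / 6) : ℝ) := by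
    rw [← Real.rpow_neg ht0.le, ← Real.rpow_add ht0]
    norm_num
  calc _ = K * (Real.sqrt t * (t ^ (-(1 / 3) : ℝ)) ^ 2 +
        (Real.sqrt t / t + Real.sqrt t / t * (t ^ (-(1 / 3) : ℝ))⁻¹)) := by ring
    _ = _ := by rw [e1, e2, e3]

/-- Contribution of the stationary point `0`, a minimum of the phase, to an oscillatory integral
whose amplitude vanishes at the other stationary point `π`. -/
lemma tendsto_sqrt_mul_integral_of_min {φ w h : ℝ → ℝ} {r : ℝ → ℂ} {φ₀ : ℝ}
    (hw : ContDiff ℝ 1 w) (hw0 : ∀ l, w l ≠ 0) (hφ : ∀ l, HasDerivAt φ (Real.sin l / w l) l)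
    (hh : ContDiff ℝ 2 h) (hh0 : ∀ l, 0 < h l)
    (hφh : ∀ l, φ l = φ₀ + (Real.sin (l / 2) * h l) ^ 2)
    (hr : ContDiff ℝ 1 r) (hrπ : r π = 0) :
    Tendsto (fun t : ℝ => (Real.sqrt t : ℂ) * (∫ l in (0 : ℝ)..π, r l * cexp (I * t * φ l)) -
      (Real.sqrt π / h 0 : ℝ) * r 0 * cexp (I * (t * φ₀ + π / 4 : ℝ))) atTop (nhds 0) := by
  set s : ℝ → ℝ := fun l => Real.sin (l / 2) * h l with hs
  have hsC : ContDiff ℝ 2 s := (Real.contDiff_sin.comp (contDiff_id.div_const 2)).mul hh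
  have hs1 : ContDiff ℝ 1 s := hsC.of_le (by norm_num)
  have hsd : Differentiable ℝ s := hsC.differentiable (by norm_num)
  have hs'C : ContDiff ℝ 1 (deriv s) := by
    have h1 : ContDiff ℝ (1 + 1) s := by rwa [one_add_one_eq_two]
    exact (contDiff_succ_iff_deriv.1 h1).2.2
  have hs0 : s 0 = 0 := by simp [hs]
  have hsπ : 0 < s π := by simpa [hs] using hh0 π
  have hs'0 : deriv s 0 = h 0 / 2 := by
    have h1 : HasDerivAt (fun l : ℝ => Real.sin (l / 2)) (Real.cos (0 / 2) * (1 / 2)) 0 :=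
      ((hasDerivAt_id (0 : ℝ)).div_const 2).sin
    have h2 := h1.mul (hh.differentiable (by norm_num) 0).hasDerivAt
    have h3 : deriv s 0 = _ := h2.deriv
    rw [h3]
    simp
    ring
  have hs'π : deriv s π = 0 := by
    have h1 : HasDerivAt φ (2 * s π * deriv s π) π := by
      have h2 := ((hsd π).hasDerivAt.pow 2).const_add φ₀
      have h3 : φ = fun l => φ₀ + s l ^ 2 := funext hφh
      rw [h3]
      simpa using h2
    have h4 := h1.unique (hφ π)
    rw [Real.sin_pi, zero_div] at h4
    rcases mul_eq_zero.1 h4 with h5 | h5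
    · linarith
    · exact h5
  set α : ℂ := r 0 * (2 / h 0 : ℝ) with hα
  set a : ℝ → ℂ := fun l => ((deriv s l : ℝ) : ℂ) * cexp (-(s l : ℂ) ^ 2) with ha
  have haC : ContDiff ℝ 1 a := by
    have h1 : ContDiff ℝ 1 fun l => ((deriv s l : ℝ) : ℂ) := ofRealCLM.contDiff.comp hs'C
    have h2 : ContDiff ℝ 1 fun l => (s l : ℂ) := ofRealCLM.contDiff.comp hs1
    exact h1.mul (h2.pow 2).neg.cexp
  have hrem := tendsto_sqrt_mul_integral_zero (r := fun l => r l - α * a l) hw hw0 hφ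
    (hr.sub (contDiff_const.mul haC))
    (by
      have : (h 0 : ℂ) ≠ 0 := ofReal_ne_zero.2 (hh0 0).ne'
      simp only [ha, hα, hs'0, hs0]
      push_cast
      simp
      field_simp
      ring)
    (by simp [ha, hs'π, hrπ])
  have hφc : Continuous φ := continuous_iff_continuousAt.2 fun l => (hφ l).continuousAt
  have href : ∀ t : ℝ, (∫ l in (0 : ℝ)..π, a l * cexp (I * t * φ l)) =
      cexp (I * t * φ₀) * ∫ u in (0 : ℝ)..(s π), cexp (-(u : ℂ) ^ 2) * cexp (I * t * (u : ℂ) ^ 2) :=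
    fun t => by
    have h1 := intervalIntegral.integral_deriv_smul_comp (a := 0) (b := π) (f := s)
      (g := fun u : ℝ => cexp (-(u : ℂ) ^ 2) * cexp (I * t * (u : ℂ) ^ 2))
      (fun l _ => (hsd l).hasDerivAt) hs'C.continuous.continuousOn (by fun_prop)
    rw [hs0] at h1
    rw [← h1, ← intervalIntegral.integral_const_mul]
    refine intervalIntegral.integral_congr fun l _ => ?_
    have h2 : φ l = φ₀ + s l ^ 2 := hφh l
    simp only [ha, h2, Function.comp, real_smul, ofReal_add, ofReal_pow, mul_add, Complex.exp_add]
    ring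
  have hfres := tendsto_sqrt_mul_fresnel hsπ
  have hfres0 : Tendsto (fun t : ℝ => α * (cexp (I * t * φ₀) * ((Real.sqrt t : ℂ) *
        (∫ u in (0 : ℝ)..(s π), cexp (-(u : ℂ) ^ 2) * cexp (I * t * (u : ℂ) ^ 2)) -
          (Real.sqrt π / 2 : ℝ) * cexp (I * (π / 4 : ℝ))))) atTop (nhds 0) := by
    have h1 := tendsto_sub_nhds_zero_iff.2 hfres
    rw [← mul_zero α]
    refine Tendsto.const_mul α ?_
    rw [tendsto_zero_iff_norm_tendsto_zero] at h1 ⊢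
    refine h1.congr fun t => ?_
    rw [norm_mul, norm_cexp_I_mul_mul, one_mul]
  have hsum := hrem.add hfres0
  rw [add_zero] at hsum
  refine hsum.congr fun t => ?_
  have hri : IntervalIntegrable (fun l => r l * cexp (I * t * φ l)) volume 0 π := by
    have := hr.continuous
    exact Continuous.intervalIntegrable (by fun_prop) _ _
  have hai : IntervalIntegrable (fun l => α * (a l * cexp (I * t * φ l))) volume 0 π := by
    have := haC.continuous
    exact Continuous.intervalIntegrable (by fun_prop) _ _
  have h1 : (∫ l in (0 : ℝ)..π, (r l - α * a l) * cexp (I * t * φ l)) =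
      (∫ l in (0 : ℝ)..π, r l * cexp (I * t * φ l)) -
        α * ∫ l in (0 : ℝ)..π, a l * cexp (I * t * φ l) := by
    rw [← intervalIntegral.integral_const_mul, ← intervalIntegral.integral_sub hri hai]
    refine intervalIntegral.integral_congr fun l _ => ?_
    ring
  rw [h1, href, hα]
  have h2 : cexp (I * (t * φ₀ + π / 4 : ℝ)) = cexp (I * t * φ₀) * cexp (I * (π / 4 : ℝ)) := by
    rw [← Complex.exp_add]
    push_cast
    ring_nf
  rw [h2]
  push_cast
  ring

/-- The dispersion relation of the harmonic chain. -/
noncomputable def dispersion (ω₀ ω₁ l : ℝ) : ℝ :=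
  Real.sqrt (ω₀ ^ 2 + 2 * ω₁ ^ 2 * (1 - Real.cos l))

section Dispersion

variable {ω₀ ω₁ : ℝ}

lemma dispersion_radicand_pos (hω₀ : 0 < ω₀) (l : ℝ) :
    0 < ω₀ ^ 2 + 2 * ω₁ ^ 2 * (1 - Real.cos l) := by
  have h1 : 0 ≤ 1 - Real.cos l := by linarith [Real.cos_le_one l]
  positivity

lemma dispersion_pos (hω₀ : 0 < ω₀) (l : ℝ) : 0 < dispersion ω₀ ω₁ l :=
  Real.sqrt_pos.2 (dispersion_radicand_pos hω₀ l)

lemma dispersion_sq (hω₀ : 0 < ω₀) (l : ℝ) :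
    dispersion ω₀ ω₁ l ^ 2 = ω₀ ^ 2 + 2 * ω₁ ^ 2 * (1 - Real.cos l) :=
  Real.sq_sqrt (dispersion_radicand_pos hω₀ l).le

lemma dispersion_zero (hω₀ : 0 < ω₀) : dispersion ω₀ ω₁ 0 = ω₀ := by
  simp [dispersion, Real.sqrt_sq hω₀.le]

lemma dispersion_two_pi_sub (l : ℝ) : dispersion ω₀ ω₁ (2 * π - l) = dispersion ω₀ ω₁ l := by
  simp [dispersion, Real.cos_two_pi_sub]

lemma contDiff_dispersion (hω₀ : 0 < ω₀) : ContDiff ℝ 2 (dispersion ω₀ ω₁) :=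
  ContDiff.sqrt (contDiff_const.add (contDiff_const.mul (contDiff_const.sub Real.contDiff_cos)))
    fun l => (dispersion_radicand_pos hω₀ l).ne'

lemma hasDerivAt_dispersion (hω₀ : 0 < ω₀) (hω₁ : 0 < ω₁) (l : ℝ) :
    HasDerivAt (dispersion ω₀ ω₁) (Real.sin l / (dispersion ω₀ ω₁ l / ω₁ ^ 2)) l := by
  have h1 := ((((Real.hasDerivAt_cos l).const_sub 1).const_mul (2 * ω₁ ^ 2)).const_add
    (ω₀ ^ 2)).sqrt (dispersion_radicand_pos hω₀ l).ne'
  refine HasDerivAt.congr_deriv h1 ?_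
  change _ / (2 * dispersion ω₀ ω₁ l) = _
  have h2 := (dispersion_pos (ω₁ := ω₁) hω₀ l).ne'
  field_simp

/-- Asymptotics of the oscillatory integral over a half period. -/
lemma tendsto_sqrt_mul_integral_half (hω₀ : 0 < ω₀) (hω₁ : 0 < ω₁) {f : ℝ → ℂ}
    (hf : ContDiff ℝ 1 f) :
    Tendsto (fun t : ℝ => (Real.sqrt t : ℂ) *
        (∫ l in (0 : ℝ)..π, f l * cexp (I * t * dispersion ω₀ ω₁ l)) -
      ((Real.sqrt π * Real.sqrt (2 * ω₀) / (2 * ω₁) : ℝ) * f 0 *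
          cexp (I * (t * ω₀ + π / 4 : ℝ)) +
        (Real.sqrt π * Real.sqrt (2 * dispersion ω₀ ω₁ π) / (2 * ω₁) : ℝ) * f π *
          cexp (I * (t * dispersion ω₀ ω₁ π - π / 4 : ℝ)))) atTop (nhds 0) := by
  set W := dispersion ω₀ ω₁ with hW
  have hWpos : ∀ l, 0 < W l := dispersion_pos hω₀
  have hWsq : ∀ l, W l ^ 2 = ω₀ ^ 2 + 2 * ω₁ ^ 2 * (1 - Real.cos l) := dispersion_sq hω₀
  have hWC : ContDiff ℝ 2 W := contDiff_dispersion hω₀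
  have hWC1 : ContDiff ℝ 1 W := hWC.of_le (by norm_num)
  have hsinsq : ∀ l : ℝ, Real.sin (l / 2) ^ 2 = (1 - Real.cos l) / 2 := fun l => by
    rw [Real.sin_sq_eq_half_sub, mul_div_cancel₀ l two_ne_zero]; ring
  have hsqrt : ∀ x : ℝ, 0 < x → (2 * ω₁ / Real.sqrt x) ^ 2 = 4 * ω₁ ^ 2 / x := fun x hx => by
    rw [div_pow, Real.sq_sqrt hx.le]; ring
  have hC : ContDiff ℝ 1 fun l : ℝ => ((Real.cos (l / 2) ^ 2 : ℝ) : ℂ) :=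
    ofRealCLM.contDiff.comp ((Real.contDiff_cos.comp (contDiff_id.div_const 2)).pow 2)
  have hS : ContDiff ℝ 1 fun l : ℝ => ((Real.sin (l / 2) ^ 2 : ℝ) : ℂ) :=
    ofRealCLM.contDiff.comp ((Real.contDiff_sin.comp (contDiff_id.div_const 2)).pow 2)
  have hmin := tendsto_sqrt_mul_integral_of_min (φ := W) (w := fun l => W l / ω₁ ^ 2)
    (h := fun l => 2 * ω₁ / Real.sqrt (W l + ω₀)) (φ₀ := ω₀)
    (r := fun l => f l * (Real.cos (l / 2) ^ 2 : ℝ))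
    (hWC1.div_const _) (fun l => (div_pos (hWpos l) (by positivity)).ne')
    (hasDerivAt_dispersion hω₀ hω₁)
    (contDiff_const.div ((hWC.add contDiff_const).sqrt fun l => (add_pos (hWpos l) hω₀).ne')
      fun l => (Real.sqrt_pos.2 (add_pos (hWpos l) hω₀)).ne')
    (fun l => div_pos (by positivity) (Real.sqrt_pos.2 (add_pos (hWpos l) hω₀)))
    (fun l => by
      have h1 := add_pos (hWpos l) hω₀
      rw [mul_pow, hsqrt _ h1, hsinsq]
      field_simp
      linear_combination 2 * hWsq l)
    (hf.mul hC) (by simp)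
  have hmax := tendsto_sqrt_mul_integral_of_min (φ := fun l => -W (π - l))
    (w := fun l => W (π - l) / ω₁ ^ 2)
    (h := fun l => 2 * ω₁ / Real.sqrt (W (π - l) + W π)) (φ₀ := -W π)
    (r := fun l => conjCLE (f (π - l) * (Real.sin ((π - l) / 2) ^ 2 : ℝ)))
    ((hWC1.comp (contDiff_const.sub contDiff_id)).div_const _)
    (fun l => (div_pos (hWpos _) (by positivity)).ne')
    (fun l => by
      have h1 := ((hasDerivAt_dispersion hω₀ hω₁ (π - l)).comp l
        ((hasDerivAt_id l).const_sub π)).neg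
      refine HasDerivAt.congr_deriv h1 ?_
      rw [Real.sin_pi_sub]
      ring)
    (contDiff_const.div (((hWC.comp (contDiff_const.sub contDiff_id)).add contDiff_const).sqrt
      fun l => (add_pos (hWpos _) (hWpos π)).ne')
      fun l => (Real.sqrt_pos.2 (add_pos (hWpos _) (hWpos π))).ne')
    (fun l => div_pos (by positivity) (Real.sqrt_pos.2 (add_pos (hWpos _) (hWpos π))))
    (fun l => by
      have h1 := add_pos (hWpos (π - l)) (hWpos π)
      have h2 := hWsq (π - l)
      have h3 := hWsq π
      rw [Real.cos_pi_sub] at h2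
      rw [Real.cos_pi] at h3
      rw [mul_pow, hsqrt _ h1, hsinsq]
      field_simp
      linear_combination 2 * h3 - 2 * h2)
    (conjCLE.contDiff.comp ((hf.mul hS).comp (contDiff_const.sub contDiff_id))) (by simp)
  have hmax' := (conjCLE.continuous.tendsto _).comp hmax
  have hsum := hmin.add hmax'
  rw [map_zero, add_zero] at hsum
  refine hsum.congr fun t => ?_
  have hfc := hf.continuous
  have hWc := hWC.continuous
  have hint1 : IntervalIntegrable (fun l => f l * (Real.cos (l / 2) ^ 2 : ℝ) *
      cexp (I * t * W l)) volume 0 π := by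
    have := hC.continuous
    exact Continuous.intervalIntegrable (by fun_prop) _ _
  have hint2 : IntervalIntegrable (fun l => f l * (Real.sin (l / 2) ^ 2 : ℝ) *
      cexp (I * t * W l)) volume 0 π := by
    have := hS.continuous
    exact Continuous.intervalIntegrable (by fun_prop) _ _
  have hrefl : (∫ l in (0 : ℝ)..π, f l * (Real.sin (l / 2) ^ 2 : ℝ) * cexp (I * t * W l)) =
      (starRingEnd ℂ) (∫ l in (0 : ℝ)..π, conjCLE (f (π - l) * (Real.sin ((π - l) / 2) ^ 2 : ℝ)) *
        cexp (I * t * (-W (π - l) : ℝ))) := by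
    have h1 := intervalIntegral.integral_comp_sub_left (a := 0) (b := π)
      (fun l => f l * (Real.sin (l / 2) ^ 2 : ℝ) * cexp (I * t * W l)) π
    rw [sub_self, sub_zero] at h1
    rw [← h1, intervalIntegral.integral_of_le Real.pi_pos.le,
      intervalIntegral.integral_of_le Real.pi_pos.le, ← integral_conj]
    refine integral_congr_ae (ae_of_all _ fun l => ?_)
    simp [← exp_conj]
  have hsplit : (∫ l in (0 : ℝ)..π, f l * cexp (I * t * W l)) =
      (∫ l in (0 : ℝ)..π, f l * (Real.cos (l / 2) ^ 2 : ℝ) * cexp (I * t * W l)) +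
        ∫ l in (0 : ℝ)..π, f l * (Real.sin (l / 2) ^ 2 : ℝ) * cexp (I * t * W l) := by
    rw [← intervalIntegral.integral_add hint1 hint2]
    refine intervalIntegral.integral_congr fun l _ => ?_
    simp only [← add_mul, ← mul_add, ← ofReal_add, Real.cos_sq_add_sin_sq, ofReal_one, mul_one]
  have e0 : W 0 = ω₀ := dispersion_zero hω₀
  have hconst : ∀ x : ℝ, Real.sqrt π / (2 * ω₁ / Real.sqrt (x + x)) =
      Real.sqrt π * Real.sqrt (2 * x) / (2 * ω₁) := fun x => by
    rw [← two_mul, div_div_eq_mul_div]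
  have hexp : (starRingEnd ℂ) (cexp (I * (t * -W π + π / 4 : ℝ))) =
      cexp (I * (t * W π - π / 4 : ℝ)) := by
    rw [← exp_conj, map_mul, conj_I, conj_ofReal]
    push_cast
    ring_nf
  rw [hsplit, hrefl]
  simp only [Function.comp, e0, hconst, sub_zero, conjCLE_apply, map_sub, map_mul, conj_ofReal, hexp,
    Complex.conj_conj]
  simp
  ring

/-- Asymptotics of the oscillatory integral over a full period. -/
lemma tendsto_sqrt_mul_integral_full (hω₀ : 0 < ω₀) (hω₁ : 0 < ω₁) {f : ℝ → ℂ}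
    (hf : ContDiff ℝ 1 f) (hf2π : f (2 * π) = f 0) :
    Tendsto (fun t : ℝ => (Real.sqrt t : ℂ) *
        (∫ l in (0 : ℝ)..(2 * π), f l * cexp (I * t * dispersion ω₀ ω₁ l)) -
      ((Real.sqrt π * Real.sqrt (2 * ω₀) / ω₁ : ℝ) * f 0 * cexp (I * (t * ω₀ + π / 4 : ℝ)) +
        (Real.sqrt π * Real.sqrt (2 * dispersion ω₀ ω₁ π) / ω₁ : ℝ) * f π *
          cexp (I * (t * dispersion ω₀ ω₁ π - π / 4 : ℝ)))) atTop (nhds 0) := by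
  have h1 := tendsto_sqrt_mul_integral_half hω₀ hω₁ hf
  have h2 := tendsto_sqrt_mul_integral_half hω₀ hω₁ (f := fun l => f (2 * π - l))
    (hf.comp (contDiff_const.sub contDiff_id))
  have hsum := h1.add h2
  rw [add_zero] at hsum
  refine hsum.congr fun t => ?_
  have hgc : Continuous fun l => f l * cexp (I * t * dispersion ω₀ ω₁ l) := by
    have := hf.continuous
    have := (contDiff_dispersion (ω₁ := ω₁) hω₀).continuous
    fun_prop
  have hrefl := intervalIntegral.integral_comp_sub_left (a := 0) (b := π)
    (fun l => f l * cexp (I * t * dispersion ω₀ ω₁ l)) (2 * π)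
  rw [show 2 * π - π = π by ring, sub_zero] at hrefl
  simp only [dispersion_two_pi_sub] at hrefl
  rw [← intervalIntegral.integral_add_adjacent_intervals (hgc.intervalIntegrable 0 π)
    (hgc.intervalIntegrable π (2 * π)), hrefl, sub_zero, hf2π, show 2 * π - π = π by ring]
  push_cast
  ring

/-- Complex conjugate version of `tendsto_sqrt_mul_integral_full`. -/
lemma tendsto_sqrt_mul_integral_full_neg (hω₀ : 0 < ω₀) (hω₁ : 0 < ω₁) {f : ℝ → ℂ}
    (hf : ContDiff ℝ 1 f) (hf2π : f (2 * π) = f 0) :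
    Tendsto (fun t : ℝ => (Real.sqrt t : ℂ) *
        (∫ l in (0 : ℝ)..(2 * π), f l * cexp (-(I * t * dispersion ω₀ ω₁ l))) -
      ((Real.sqrt π * Real.sqrt (2 * ω₀) / ω₁ : ℝ) * f 0 * cexp (-(I * (t * ω₀ + π / 4 : ℝ))) +
        (Real.sqrt π * Real.sqrt (2 * dispersion ω₀ ω₁ π) / ω₁ : ℝ) * f π *
          cexp (-(I * (t * dispersion ω₀ ω₁ π - π / 4 : ℝ))))) atTop (nhds 0) := by
  have h1 := tendsto_sqrt_mul_integral_full hω₀ hω₁ (f := fun l => conjCLE (f l))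
    (conjCLE.contDiff.comp hf) (congrArg _ hf2π)
  have h2 := (conjCLE.continuous.tendsto _).comp h1
  rw [map_zero] at h2
  refine h2.congr fun t => ?_
  have hconj : (∫ l in (0 : ℝ)..(2 * π), f l * cexp (-(I * t * dispersion ω₀ ω₁ l))) =
      (starRingEnd ℂ) (∫ l in (0 : ℝ)..(2 * π), conjCLE (f l) *
        cexp (I * t * dispersion ω₀ ω₁ l)) := by
    rw [intervalIntegral.integral_of_le Real.two_pi_pos.le,
      intervalIntegral.integral_of_le Real.two_pi_pos.le, ← integral_conj]
    refine integral_congr_ae (ae_of_all _ fun l => ?_)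
    simp [← exp_conj]
  rw [hconj]
  simp only [Function.comp, conjCLE_apply, map_sub, map_add, map_mul, conj_ofReal, ← exp_conj,
    Complex.conj_conj, conj_I, neg_mul]

/-- Asymptotics of the cosine transform along the dispersion relation. -/
lemma tendsto_sqrt_mul_integral_cos (hω₀ : 0 < ω₀) (hω₁ : 0 < ω₁) {f : ℝ → ℂ}
    (hf : ContDiff ℝ 1 f) (hf2π : f (2 * π) = f 0) :
    Tendsto (fun t : ℝ => (Real.sqrt t : ℂ) *
        (∫ l in (0 : ℝ)..(2 * π), f l * (Real.cos (t * dispersion ω₀ ω₁ l) : ℂ)) -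
      ((Real.sqrt π * Real.sqrt (2 * ω₀) / ω₁ : ℝ) * f 0 * (Real.cos (t * ω₀ + π / 4) : ℂ) +
        (Real.sqrt π * Real.sqrt (2 * dispersion ω₀ ω₁ π) / ω₁ : ℝ) * f π *
          (Real.cos (t * dispersion ω₀ ω₁ π - π / 4) : ℂ))) atTop (nhds 0) := by
  have hsum := ((tendsto_sqrt_mul_integral_full hω₀ hω₁ hf hf2π).add
    (tendsto_sqrt_mul_integral_full_neg hω₀ hω₁ hf hf2π)).const_mul (1 / 2)
  rw [add_zero, mul_zero] at hsum
  refine hsum.congr fun t => ?_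
  have hfc := hf.continuous
  have hWc := (contDiff_dispersion (ω₁ := ω₁) hω₀).continuous
  have hcos : ∀ x : ℝ, (Real.cos x : ℂ) = (cexp (I * x) + cexp (-(I * x))) / 2 := fun x => by
    rw [ofReal_cos, Complex.cos, mul_comm I, neg_mul]
  have hint : (∫ l in (0 : ℝ)..(2 * π), f l * (Real.cos (t * dispersion ω₀ ω₁ l) : ℂ)) =
      1 / 2 * ((∫ l in (0 : ℝ)..(2 * π), f l * cexp (I * t * dispersion ω₀ ω₁ l)) +
        ∫ l in (0 : ℝ)..(2 * π), f l * cexp (-(I * t * dispersion ω₀ ω₁ l))) := by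
    rw [← intervalIntegral.integral_add (Continuous.intervalIntegrable (by fun_prop) _ _)
      (Continuous.intervalIntegrable (by fun_prop) _ _), ← intervalIntegral.integral_const_mul]
    refine intervalIntegral.integral_congr fun l _ => ?_
    simp only [hcos, ofReal_mul, mul_assoc]
    ring
  rw [hint, hcos, hcos]
  ring

/-- Asymptotics of the sine transform along the dispersion relation. -/
lemma tendsto_sqrt_mul_integral_sin (hω₀ : 0 < ω₀) (hω₁ : 0 < ω₁) {f : ℝ → ℂ}
    (hf : ContDiff ℝ 1 f) (hf2π : f (2 * π) = f 0) :
    Tendsto (fun t : ℝ => (Real.sqrt t : ℂ) *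
        (∫ l in (0 : ℝ)..(2 * π), f l * (Real.sin (t * dispersion ω₀ ω₁ l) : ℂ)) -
      ((Real.sqrt π * Real.sqrt (2 * ω₀) / ω₁ : ℝ) * f 0 * (Real.sin (t * ω₀ + π / 4) : ℂ) +
        (Real.sqrt π * Real.sqrt (2 * dispersion ω₀ ω₁ π) / ω₁ : ℝ) * f π *
          (Real.sin (t * dispersion ω₀ ω₁ π - π / 4) : ℂ))) atTop (nhds 0) := by
  have hsum := ((tendsto_sqrt_mul_integral_full_neg hω₀ hω₁ hf hf2π).sub
    (tendsto_sqrt_mul_integral_full hω₀ hω₁ hf hf2π)).const_mul (I / 2)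
  rw [sub_zero, mul_zero] at hsum
  refine hsum.congr fun t => ?_
  have hfc := hf.continuous
  have hWc := (contDiff_dispersion (ω₁ := ω₁) hω₀).continuous
  have hsin : ∀ x : ℝ, (Real.sin x : ℂ) = (cexp (-(I * x)) - cexp (I * x)) * (I / 2) := fun x => by
    rw [ofReal_sin, Complex.sin, mul_comm I, neg_mul, mul_div_assoc]
  have hint : (∫ l in (0 : ℝ)..(2 * π), f l * (Real.sin (t * dispersion ω₀ ω₁ l) : ℂ)) =
      I / 2 * ((∫ l in (0 : ℝ)..(2 * π), f l * cexp (-(I * t * dispersion ω₀ ω₁ l))) -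
        ∫ l in (0 : ℝ)..(2 * π), f l * cexp (I * t * dispersion ω₀ ω₁ l)) := by
    rw [← intervalIntegral.integral_sub (Continuous.intervalIntegrable (by fun_prop) _ _)
      (Continuous.intervalIntegrable (by fun_prop) _ _), ← intervalIntegral.integral_const_mul]
    refine intervalIntegral.integral_congr fun l _ => ?_
    simp only [hsin, ofReal_mul, mul_assoc]
    ring
  rw [hint, hsin, hsin]
  ring

end Dispersion

/-- For `ω₀ > 0` and fixed `k`, the solution has the two-frequency
`1/√t` asymptotics as `t → ∞`. -/
theorem harmonic_chain_time_asymptotics_pos (ω₀ ω₁ : ℝ) (hω₀ : 0 < ω₀) (hω₁ : 0 < ω₁)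
    (ω : ℝ → ℝ) (hω : ∀ l : ℝ, ω l = Real.sqrt (ω₀ ^ 2 + 2 * ω₁ ^ 2 * (1 - Real.cos l)))
    (ω₀' : ℝ) (hω₀' : ω₀' = Real.sqrt (ω₀ ^ 2 + 4 * ω₁ ^ 2))
    (Q P : ℝ → ℂ) (hQ : ContDiff ℝ 2 Q) (hP : ContDiff ℝ 2 P)
    (hQper : Function.Periodic Q (2 * π)) (hPper : Function.Periodic P (2 * π))
    (q : ℤ → ℝ → ℂ)
    (hq : ∀ (k : ℤ) (t : ℝ), q k t =
      (1 / (2 * (π : ℂ))) * ∫ l in (0:ℝ)..(2 * π),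
        (Q l * (Real.cos (t * ω l) : ℂ) + P l * ((Real.sin (t * ω l) / ω l : ℝ) : ℂ)) *
          Complex.exp (-Complex.I * (k : ℂ) * (l : ℂ)))
    (C₁ S₁ C₂ S₂ : ℂ)
    (hC₁ : C₁ = ((1 / ω₁) * Real.sqrt (ω₀ / (2 * π)) : ℝ) * Q 0)
    (hS₁ : S₁ = ((1 / (ω₁ * ω₀)) * Real.sqrt (ω₀ / (2 * π)) : ℝ) * P 0)
    (hC₂ : C₂ = ((1 / ω₁) * Real.sqrt (ω₀' / (2 * π)) : ℝ) * Q π)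
    (hS₂ : S₂ = ((1 / (ω₁ * ω₀')) * Real.sqrt (ω₀' / (2 * π)) : ℝ) * P π) :
    ∀ k : ℤ,
      Tendsto (fun t : ℝ =>
          (Real.sqrt t : ℂ) * q k t -
            (C₁ * (Real.cos (t * ω₀ + π / 4) : ℂ) + S₁ * (Real.sin (t * ω₀ + π / 4) : ℂ) +
              (-1 : ℂ) ^ k * C₂ * (Real.cos (t * ω₀' - π / 4) : ℂ) +
              (-1 : ℂ) ^ k * S₂ * (Real.sin (t * ω₀' - π / 4) : ℂ)))
        atTop (nhds 0) := by
  intro k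
  obtain rfl : ω = dispersion ω₀ ω₁ := funext hω
  have hWπ : dispersion ω₀ ω₁ π = ω₀' := by
    rw [hω₀', dispersion, Real.cos_pi]
    ring_nf
  have hω₀'pos : 0 < ω₀' := hWπ ▸ dispersion_pos hω₀ π
  have hWpos : ∀ l, 0 < dispersion ω₀ ω₁ l := dispersion_pos hω₀
  have hW1 : ContDiff ℝ 1 fun l => (dispersion ω₀ ω₁ l : ℂ) :=
    ofRealCLM.contDiff.comp ((contDiff_dispersion hω₀).of_le (by norm_num))
  have hE : ContDiff ℝ 1 fun l : ℝ => cexp (-I * (k : ℂ) * (l : ℂ)) :=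
    (contDiff_const.mul ofRealCLM.contDiff).cexp
  have hE0 : cexp (-I * (k : ℂ) * ((0 : ℝ) : ℂ)) = 1 := by simp
  have hEπ : cexp (-I * (k : ℂ) * (π : ℂ)) = (-1) ^ k := by
    rw [show -I * (k : ℂ) * (π : ℂ) = k * (-(π * I)) by ring, Complex.exp_int_mul, Complex.exp_neg,
      exp_pi_mul_I, inv_neg, inv_one]
  have hE2π : cexp (-I * (k : ℂ) * ((2 * π : ℝ) : ℂ)) = 1 := by
    rw [show -I * (k : ℂ) * ((2 * π : ℝ) : ℂ) = ((-k : ℤ) : ℂ) * (2 * π * I) by push_cast; ring,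
      exp_int_mul_two_pi_mul_I]
  have hQ2π : Q (2 * π) = Q 0 := by simpa using hQper 0
  have hP2π : P (2 * π) = P 0 := by simpa using hPper 0
  have hW2π : dispersion ω₀ ω₁ (2 * π) = dispersion ω₀ ω₁ 0 := by
    simpa using dispersion_two_pi_sub (ω₀ := ω₀) (ω₁ := ω₁) 0
  have hQE : ContDiff ℝ 1 fun l : ℝ => Q l * cexp (-I * (k : ℂ) * (l : ℂ)) :=
    (hQ.of_le (by norm_num)).mul hE
  have hPE : ContDiff ℝ 1 fun l : ℝ =>
      P l / (dispersion ω₀ ω₁ l : ℂ) * cexp (-I * (k : ℂ) * (l : ℂ)) := by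
    simp only [div_eq_mul_inv]
    exact ((hP.of_le (by norm_num)).mul (hW1.inv fun l => ofReal_ne_zero.2 (hWpos l).ne')).mul hE
  have hcos := tendsto_sqrt_mul_integral_cos hω₀ hω₁ hQE (by simp only [hE2π, hE0, hQ2π])
  have hsin := tendsto_sqrt_mul_integral_sin hω₀ hω₁ hPE
    (by simp only [hE2π, hE0, hP2π, hW2π])
  have hsum := (hcos.add hsin).const_mul (1 / (2 * (π : ℂ)))
  rw [add_zero, mul_zero] at hsum
  refine hsum.congr fun t => ?_
  have hWc := (contDiff_dispersion (ω₁ := ω₁) hω₀).continuous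
  have hint : (∫ l in (0 : ℝ)..(2 * π),
      (Q l * (Real.cos (t * dispersion ω₀ ω₁ l) : ℂ) +
        P l * ((Real.sin (t * dispersion ω₀ ω₁ l) / dispersion ω₀ ω₁ l : ℝ) : ℂ)) *
          cexp (-I * (k : ℂ) * (l : ℂ))) =
      (∫ l in (0 : ℝ)..(2 * π), Q l * cexp (-I * (k : ℂ) * (l : ℂ)) *
        (Real.cos (t * dispersion ω₀ ω₁ l) : ℂ)) +
      ∫ l in (0 : ℝ)..(2 * π), P l / (dispersion ω₀ ω₁ l : ℂ) * cexp (-I * (k : ℂ) * (l : ℂ)) *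
        (Real.sin (t * dispersion ω₀ ω₁ l) : ℂ) := by
    have hc : Continuous fun l => (Real.cos (t * dispersion ω₀ ω₁ l) : ℂ) :=
      continuous_ofReal.comp (Real.continuous_cos.comp (continuous_const.mul hWc))
    have hs : Continuous fun l => (Real.sin (t * dispersion ω₀ ω₁ l) : ℂ) :=
      continuous_ofReal.comp (Real.continuous_sin.comp (continuous_const.mul hWc))
    refine Eq.trans ?_ (intervalIntegral.integral_add
      ((hQE.continuous.mul hc).intervalIntegrable _ _)
      ((hPE.continuous.mul hs).intervalIntegrable _ _))
    refine intervalIntegral.integral_congr fun l _ => ?_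
    simp only [ofReal_div]
    ring
  have hconst : ∀ x : ℝ, 0 < x →
      1 / (2 * π) * (Real.sqrt π * Real.sqrt (2 * x) / ω₁) =
        1 / ω₁ * Real.sqrt (x / (2 * π)) := fun x hx => by
    have h1 : Real.sqrt (x / (2 * π)) = Real.sqrt π * Real.sqrt (2 * x) / (2 * π) := by
      rw [← Real.sqrt_mul Real.pi_pos.le, Real.sqrt_eq_iff_eq_sq (by positivity) (by positivity),
        div_pow, Real.sq_sqrt (by positivity)]
      field_simp
    rw [h1]
    ring
  have c0 := congrArg (fun x : ℝ => (x : ℂ)) (hconst ω₀ hω₀)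
  have cπ := congrArg (fun x : ℝ => (x : ℂ)) (hconst ω₀' hω₀'pos)
  simp only [ofReal_mul, ofReal_div, ofReal_one, ofReal_ofNat] at c0 cπ
  rw [hq, hint, hC₁, hS₁, hC₂, hS₂]
  simp only [hE0, hEπ, hWπ, dispersion_zero hω₀, ofReal_mul, ofReal_div, ofReal_one]
  linear_combination
    (-(Q 0 * (Real.cos (t * ω₀ + π / 4) : ℂ) + P 0 / ω₀ * (Real.sin (t * ω₀ + π / 4) : ℂ))) * c0 -
      ((-1) ^ k * (Q π * (Real.cos (t * ω₀' - π / 4) : ℂ) +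
        P π / ω₀' * (Real.sin (t * ω₀' - π / 4) : ℂ))) * cπ
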